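/- Let (A,Ω) be a relative fractal drum in ℝ^N which is Minkowski nondegenerate, i.e., D := dim_B(A,Ω) exists and 0 < M_*^D(A,Ω) ≤ M^{*D}(A,Ω) < ∞, and assume D < N. Let U ⊆ ℂ be an open connected neighborhood of D and let F be meromorphic on U with F(s) = ζ^𝔐_{A,Ω}(s) for all s ∈ U with D < Re s < N. Then D is a simple pole of F: the limit r := lim_{s→D}(s−D)F(s) exists, is real and nonzero; moreover M_*^D(A,Ω) ≤ r ≤ M^{*D}(A,Ω), and if in addition (A,Ω) is Minkowski measurable then r = M^D(A,Ω). -/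

import Mathlib

open MeasureTheory Filter Complex Set Metric Topology Asymptotics
open scoped ENNReal NNReal

noncomputable section

/-- The open `t`-neighborhood `A_t = {x : dist(x,A) < t}` of a set `A ⊆ ℝ^N`. -/
def nbhd (N : ℕ) (A : Set (EuclideanSpace ℝ (Fin N))) (t : ℝ) :
    Set (EuclideanSpace ℝ (Fin N)) :=
  {x | Metric.infDist x A < t}

/-- The volume `|A_t ∩ Ω|` of the `t`-neighborhood of `A` relative to `Ω`. -/
def tubeVol (N : ℕ) (A Ω : Set (EuclideanSpace ℝ (Fin N))) (t : ℝ) : ℝ :=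
  (volume (nbhd N A t ∩ Ω)).toReal

/-- The upper `r`-dimensional Minkowski content of the relative fractal drum `(A,Ω)`. -/
def upperContent (N : ℕ) (A Ω : Set (EuclideanSpace ℝ (Fin N))) (r : ℝ) : ℝ≥0∞ :=
  Filter.limsup
    (fun t : ℝ => volume (nbhd N A t ∩ Ω) / ENNReal.ofReal (t ^ ((N : ℝ) - r)))
    (nhdsWithin 0 (Set.Ioi 0))

/-- The lower `r`-dimensional Minkowski content of the relative fractal drum `(A,Ω)`. -/
def lowerContent (N : ℕ) (A Ω : Set (EuclideanSpace ℝ (Fin N))) (r : ℝ) : ℝ≥0∞ :=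
  Filter.liminf
    (fun t : ℝ => volume (nbhd N A t ∩ Ω) / ENNReal.ofReal (t ^ ((N : ℝ) - r)))
    (nhdsWithin 0 (Set.Ioi 0))

/-- `D` is the (finite) upper box (Minkowski) dimension of `(A,Ω)`:
the greatest lower bound of `{r : M^{*r}(A,Ω) = 0}`. -/
def IsUpperMinkDim (N : ℕ) (A Ω : Set (EuclideanSpace ℝ (Fin N))) (D : ℝ) : Prop :=
  IsGLB {r : ℝ | upperContent N A Ω r = 0} D

/-- `D` is the (finite) lower box (Minkowski) dimension of `(A,Ω)`. -/
def IsLowerMinkDim (N : ℕ) (A Ω : Set (EuclideanSpace ℝ (Fin N))) (D : ℝ) : Prop :=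
  IsGLB {r : ℝ | lowerContent N A Ω r = 0} D

/-- The box (Minkowski) dimension of `(A,Ω)` exists and equals `D`. -/
def IsMinkDim (N : ℕ) (A Ω : Set (EuclideanSpace ℝ (Fin N))) (D : ℝ) : Prop :=
  IsUpperMinkDim N A Ω D ∧ IsLowerMinkDim N A Ω D

/-- `(A,Ω)` is a relative fractal drum in `ℝ^N`. -/
def IsRFD (N : ℕ) (A Ω : Set (EuclideanSpace ℝ (Fin N))) : Prop :=
  A.Nonempty ∧ MeasurableSet Ω ∧ volume Ω < ⊤ ∧ ∃ δ₀ > (0 : ℝ), Ω ⊆ nbhd N A δ₀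

/-- The relative distance zeta function `ζ_{A,Ω}(s) = ∫_Ω d(x,A)^{s-N} dx`. -/
def distZeta (N : ℕ) (A Ω : Set (EuclideanSpace ℝ (Fin N))) (s : ℂ) : ℂ :=
  ∫ x in Ω, (Metric.infDist x A : ℂ) ^ (s - (N : ℂ))

/-- The relative distance zeta function with parameter `δ`:
`ζ_{A,Ω}(s;δ) = ∫_{A_δ ∩ Ω} d(x,A)^{s-N} dx`. -/
def distZetaD (N : ℕ) (A Ω : Set (EuclideanSpace ℝ (Fin N))) (δ : ℝ) (s : ℂ) : ℂ :=
  ∫ x in nbhd N A δ ∩ Ω, (Metric.infDist x A : ℂ) ^ (s - (N : ℂ))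

/-- The relative tube zeta function `ζ̃_{A,Ω}(s;δ) = ∫_0^δ t^{s-N-1}|A_t ∩ Ω| dt`. -/
def tubeZeta (N : ℕ) (A Ω : Set (EuclideanSpace ℝ (Fin N))) (δ : ℝ) (s : ℂ) : ℂ :=
  ∫ t in Set.Ioc (0 : ℝ) δ, (t : ℂ) ^ (s - (N : ℂ) - 1) * ((tubeVol N A Ω t : ℝ) : ℂ)

/-- The Mellin zeta function `ζ^𝔐_{A,Ω}(s) = ∫_0^∞ t^{s-N-1}|A_t ∩ Ω| dt`. -/
def mellinZeta (N : ℕ) (A Ω : Set (EuclideanSpace ℝ (Fin N))) (s : ℂ) : ℂ :=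
  ∫ t in Set.Ioi (0 : ℝ), (t : ℂ) ^ (s - (N : ℂ) - 1) * ((tubeVol N A Ω t : ℝ) : ℂ)

/-- `(A,Ω)` is Minkowski measurable with dimension `D` and Minkowski content `M`. -/
def MinkMeasurable (N : ℕ) (A Ω : Set (EuclideanSpace ℝ (Fin N))) (D M : ℝ) : Prop :=
  0 < M ∧
    Tendsto (fun t : ℝ => tubeVol N A Ω t / t ^ ((N : ℝ) - D))
      (nhdsWithin 0 (Set.Ioi 0)) (nhds M)

/-- `ω` is a pole of `F` (the norm of `F` blows up at `ω`). -/
def IsPoleAt (F : ℂ → ℂ) (ω : ℂ) : Prop :=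
  Tendsto (fun s => ‖F s‖) (nhdsWithin ω {ω}ᶜ) atTop

/-- The languidity conditions **L1**–**L2** for `F` with screen `S`, exponent `κ`,
constants `c`, `C` and two-sided sequence `T`. -/
def LanguidWith (F : ℂ → ℂ) (S : ℝ → ℝ) (κ c C : ℝ) (T : ℤ → ℝ) : Prop :=
  0 < C ∧
  (∀ n : ℤ, 1 ≤ n → T (-n) < 0 ∧ 0 < T n) ∧
  Tendsto (fun n : ℕ => T (n : ℤ)) atTop atTop ∧
  Tendsto (fun n : ℕ => T (-(n : ℤ))) atTop atBot ∧
  (∀ n : ℤ, ∀ σ : ℝ, S (T n) < σ → σ < c →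
    ‖F ((σ : ℂ) + (T n : ℝ) * Complex.I)‖ ≤ C * (|T n| + 1) ^ κ) ∧
  (∀ τ : ℝ, 1 ≤ |τ| → ‖F ((S τ : ℂ) + (τ : ℝ) * Complex.I)‖ ≤ C * |τ| ^ κ)

/-- `S` is a screen (for upper box dimension `D`): a Lipschitz function bounded below,
with `sup S ≤ D`. -/
def IsScreen (S : ℝ → ℝ) (D : ℝ) : Prop :=
  (∃ K : NNReal, LipschitzWith K S) ∧ BddBelow (Set.range S) ∧ ∀ τ : ℝ, S τ ≤ D

/-- The window associated with the screen `S`. -/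
def window (S : ℝ → ℝ) : Set ℂ :=
  {s : ℂ | S s.im ≤ s.re}

/-- Elementary bounds for the Mellin transform of a bounded function comparable to `t ^ α`
near the origin. -/
theorem mul_mellin_bounds {V : ℝ → ℝ} {K a b α δ x : ℝ} (hV : Measurable V)
    (hV0 : ∀ t, 0 ≤ V t) (hVK : ∀ t, V t ≤ K) (hδ : 0 < δ)
    (hab : ∀ t ∈ Ioc 0 δ, a * t ^ α ≤ V t ∧ V t ≤ b * t ^ α) (hx : 0 < x) (hxα : x < α) :
    a * δ ^ x ≤ x * ∫ t in Ioi (0 : ℝ), t ^ (x - α - 1) * V t ∧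
      x * (∫ t in Ioi (0 : ℝ), t ^ (x - α - 1) * V t) ≤
        b * δ ^ x + x * (K * (δ ^ (x - α) / (α - x))) := by
  have hmeas : Measurable fun t : ℝ => t ^ (x - α - 1) * V t := by fun_prop
  have hpow : IntegrableOn (fun t : ℝ => t ^ (x - 1)) (Ioc 0 δ) :=
    (intervalIntegrable_iff_integrableOn_Ioc_of_le hδ.le).1
      (intervalIntegral.intervalIntegrable_rpow' (by linarith))
  have hpowval : ∫ t in Ioc (0 : ℝ) δ, t ^ (x - 1) = δ ^ x / x := by
    rw [← intervalIntegral.integral_of_le hδ.le, integral_rpow (Or.inl (by linarith))]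
    simp [Real.zero_rpow hx.ne']
  have hsplit : ∀ t ∈ Ioc (0 : ℝ) δ, ∀ c : ℝ,
      t ^ (x - α - 1) * (c * t ^ α) = c * t ^ (x - 1) := by
    intro t ht c
    rw [mul_left_comm, ← Real.rpow_add ht.1]
    ring_nf
  have hlow : ∀ t ∈ Ioc (0 : ℝ) δ, a * t ^ (x - 1) ≤ t ^ (x - α - 1) * V t := fun t ht => by
    rw [← hsplit t ht]
    exact mul_le_mul_of_nonneg_left (hab t ht).1 (Real.rpow_nonneg ht.1.le _)
  have hupp : ∀ t ∈ Ioc (0 : ℝ) δ, t ^ (x - α - 1) * V t ≤ b * t ^ (x - 1) := fun t ht => by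
    rw [← hsplit t ht]
    exact mul_le_mul_of_nonneg_left (hab t ht).2 (Real.rpow_nonneg ht.1.le _)
  have hnear : IntegrableOn (fun t : ℝ => t ^ (x - α - 1) * V t) (Ioc 0 δ) := by
    refine (hpow.const_mul b).mono' hmeas.aestronglyMeasurable ?_
    refine (ae_restrict_iff' measurableSet_Ioc).2 (ae_of_all _ fun t ht => ?_)
    rw [Real.norm_of_nonneg (mul_nonneg (Real.rpow_nonneg ht.1.le _) (hV0 t))]
    exact hupp t ht
  have htailpow : IntegrableOn (fun t : ℝ => t ^ (x - α - 1)) (Ioi δ) :=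
    integrableOn_Ioi_rpow_of_lt (by linarith) hδ
  have htailpowval : ∫ t in Ioi δ, t ^ (x - α - 1) = δ ^ (x - α) / (α - x) := by
    rw [integral_Ioi_rpow_of_lt (by linarith) hδ, sub_add_cancel, neg_div, ← div_neg, neg_sub]
  have htailnn : ∀ t ∈ Ioi δ, 0 ≤ t ^ (x - α - 1) * V t := fun t ht =>
    mul_nonneg (Real.rpow_nonneg (hδ.trans ht).le _) (hV0 t)
  have htailupp : ∀ t ∈ Ioi δ, t ^ (x - α - 1) * V t ≤ K * t ^ (x - α - 1) := fun t ht => by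
    rw [mul_comm]
    exact mul_le_mul_of_nonneg_right (hVK t) (Real.rpow_nonneg (hδ.trans ht).le _)
  have hfar : IntegrableOn (fun t : ℝ => t ^ (x - α - 1) * V t) (Ioi δ) := by
    refine (htailpow.const_mul K).mono' hmeas.aestronglyMeasurable ?_
    refine (ae_restrict_iff' measurableSet_Ioi).2 (ae_of_all _ fun t ht => ?_)
    rw [Real.norm_of_nonneg (htailnn t ht)]
    exact htailupp t ht
  have h₁ := setIntegral_mono_on (hpow.const_mul a) hnear measurableSet_Ioc hlow
  have h₂ := setIntegral_mono_on hnear (hpow.const_mul b) measurableSet_Ioc hupp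
  have h₃ := setIntegral_nonneg (μ := volume) measurableSet_Ioi htailnn
  have h₄ := setIntegral_mono_on hfar (htailpow.const_mul K) measurableSet_Ioi htailupp
  rw [integral_const_mul, hpowval] at h₁ h₂
  rw [integral_const_mul, htailpowval] at h₄
  rw [← Ioc_union_Ioi_eq_Ioi hδ.le,
    setIntegral_union (Ioc_disjoint_Ioi le_rfl) measurableSet_Ioi hnear hfar, mul_add]
  have hc : ∀ c : ℝ, x * (c * (δ ^ x / x)) = c * δ ^ x := fun c => by field_simp
  constructor
  · linarith [hc a, mul_le_mul_of_nonneg_left h₁ hx.le, mul_nonneg hx.le h₃]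
  · linarith [hc b, mul_le_mul_of_nonneg_left h₂ hx.le, mul_le_mul_of_nonneg_left h₄ hx.le]

/-- If `a * t ^ α ≤ V t ≤ b * t ^ α` near the origin, then every limit of `x` times the Mellin
transform of `V` at `x - α` lies between `a` and `b`. -/
theorem mem_Icc_of_tendsto_mul_mellin {V : ℝ → ℝ} {K α r : ℝ} (hV : Measurable V)
    (hV0 : ∀ t, 0 ≤ V t) (hVK : ∀ t, V t ≤ K) (hα : 0 < α)
    (hr : Tendsto (fun x : ℝ => x * ∫ t in Ioi (0 : ℝ), t ^ (x - α - 1) * V t)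
      (𝓝[>] 0) (𝓝 r)) {a b : ℝ}
    (hab : ∀ᶠ t in 𝓝[>] (0 : ℝ), a * t ^ α ≤ V t ∧ V t ≤ b * t ^ α) :
    r ∈ Icc a b := by
  obtain ⟨δ, hδ, hδab⟩ := mem_nhdsGT_iff_exists_Ioc_subset.1 hab
  have hδ' : (0 : ℝ) < δ := hδ
  have hbd : ∀ᶠ x in 𝓝[>] (0 : ℝ), 0 < x ∧ x < α :=
    Ioo_mem_nhdsGT hα
  have hcont : ∀ f : ℝ → ℝ, ContinuousAt f 0 → Tendsto f (𝓝[>] 0) (𝓝 (f 0)) :=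
    fun f hf => hf.tendsto.mono_left nhdsWithin_le_nhds
  have hlow := hcont (fun x => a * δ ^ x) (by fun_prop (disch := simp [hδ'.ne']))
  have hupp := hcont (fun x => b * δ ^ x + x * (K * (δ ^ (x - α) / (α - x))))
    (by fun_prop (disch := simp [hδ'.ne', hα.ne']))
  simp only [Real.rpow_zero, mul_one, zero_mul, add_zero] at hlow hupp
  constructor
  · refine le_of_tendsto_of_tendsto hlow hr (hbd.mono fun x hx => ?_)
    exact (mul_mellin_bounds hV hV0 hVK hδ (fun t ht => hδab ht) hx.1 hx.2).1
  · refine le_of_tendsto_of_tendsto hr hupp (hbd.mono fun x hx => ?_)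
    exact (mul_mellin_bounds hV hV0 hVK hδ (fun t ht => hδab ht) hx.1 hx.2).2

/-- If `0 ≤ V t ≤ b * t ^ α` near the origin, then `x` times the Mellin transform of `V` at
`x - α` stays bounded as `x` decreases to `0`. -/
theorem exists_eventually_abs_mul_mellin_le {V : ℝ → ℝ} {K α b : ℝ} (hV : Measurable V)
    (hV0 : ∀ t, 0 ≤ V t) (hVK : ∀ t, V t ≤ K) (hα : 0 < α)
    (hb : ∀ᶠ t in 𝓝[>] (0 : ℝ), V t ≤ b * t ^ α) :
    ∃ B : ℝ, ∀ᶠ x in 𝓝[>] (0 : ℝ),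
      |x * ∫ t in Ioi (0 : ℝ), t ^ (x - α - 1) * V t| ≤ B := by
  obtain ⟨δ, hδ, hδb⟩ := mem_nhdsGT_iff_exists_Ioc_subset.1 hb
  have hδ' : (0 : ℝ) < δ := hδ
  have hcont : ContinuousAt (fun x => b * δ ^ x + x * (K * (δ ^ (x - α) / (α - x)))) 0 := by
    fun_prop (disch := simp [hδ'.ne', hα.ne'])
  have hlt := (hcont.tendsto.mono_left (nhdsWithin_le_nhds (s := Ioi 0))).eventually_lt_const
    (lt_add_one _)
  refine ⟨b * δ ^ (0 : ℝ) + 0 * (K * (δ ^ (0 - α) / (α - 0))) + 1, ?_⟩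
  filter_upwards [hlt, Ioo_mem_nhdsGT hα] with x hx hx'
  have h := mul_mellin_bounds (a := 0) hV hV0 hVK hδ
    (fun t ht => ⟨by simpa using hV0 t, hδb ht⟩) hx'.1 hx'.2
  rw [zero_mul] at h
  rw [abs_of_nonneg h.1]
  exact h.2.trans hx.le

theorem nbhd_mono (N : ℕ) (A : Set (EuclideanSpace ℝ (Fin N))) : Monotone (nbhd N A) :=
  fun _ _ h _ hx => lt_of_lt_of_le hx h

theorem tubeVol_nonneg (N : ℕ) (A Ω : Set (EuclideanSpace ℝ (Fin N))) (t : ℝ) :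
    0 ≤ tubeVol N A Ω t :=
  ENNReal.toReal_nonneg

section FiniteVolume

variable {N : ℕ} {A Ω : Set (EuclideanSpace ℝ (Fin N))}

theorem volume_nbhd_inter_ne_top (hΩ : volume Ω < ⊤) (t : ℝ) :
    volume (nbhd N A t ∩ Ω) ≠ ⊤ :=
  ((measure_mono inter_subset_right).trans_lt hΩ).ne

theorem tubeVol_le (hΩ : volume Ω < ⊤) (t : ℝ) : tubeVol N A Ω t ≤ (volume Ω).toReal :=
  ENNReal.toReal_mono hΩ.ne (measure_mono inter_subset_right)

theorem monotone_tubeVol (hΩ : volume Ω < ⊤) : Monotone (tubeVol N A Ω) := fun _ t h =>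
  ENNReal.toReal_mono (volume_nbhd_inter_ne_top hΩ t)
    (measure_mono (inter_subset_inter_left _ (nbhd_mono N A h)))

theorem eventually_le_tubeVol_of_lt_lowerContent (hΩ : volume Ω < ⊤) {r a : ℝ}
    (ha : ENNReal.ofReal a < lowerContent N A Ω r) :
    ∀ᶠ t in 𝓝[>] (0 : ℝ), a * t ^ ((N : ℝ) - r) ≤ tubeVol N A Ω t := by
  filter_upwards [eventually_lt_of_lt_liminf ha, self_mem_nhdsWithin] with t ht ht0
  have hpos : 0 < t ^ ((N : ℝ) - r) := Real.rpow_pos_of_pos ht0 _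
  have h := (ENNReal.le_div_iff_mul_le (Or.inl (by simpa using hpos))
    (Or.inl ENNReal.ofReal_ne_top)).1 ht.le
  rw [← ENNReal.ofReal_mul' hpos.le] at h
  exact (ENNReal.ofReal_le_iff_le_toReal (volume_nbhd_inter_ne_top hΩ t)).1 h

theorem eventually_tubeVol_le_of_upperContent_lt {r b : ℝ} (hb0 : 0 ≤ b)
    (hb : upperContent N A Ω r < ENNReal.ofReal b) :
    ∀ᶠ t in 𝓝[>] (0 : ℝ), tubeVol N A Ω t ≤ b * t ^ ((N : ℝ) - r) := by
  filter_upwards [eventually_lt_of_limsup_lt hb, self_mem_nhdsWithin] with t ht ht0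
  have hpos : 0 < t ^ ((N : ℝ) - r) := Real.rpow_pos_of_pos ht0 _
  have h := (ENNReal.div_le_iff_le_mul (Or.inl (by simpa using hpos))
    (Or.inl ENNReal.ofReal_ne_top)).1 ht.le
  rw [← ENNReal.ofReal_mul' hpos.le] at h
  exact ENNReal.toReal_le_of_le_ofReal (by positivity) h

end FiniteVolume

theorem mellinZeta_ofReal (N : ℕ) (A Ω : Set (EuclideanSpace ℝ (Fin N))) (σ : ℝ) :
    mellinZeta N A Ω σ =
      ((∫ t in Ioi (0 : ℝ), t ^ (σ - N - 1) * tubeVol N A Ω t : ℝ) : ℂ) := by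
  rw [mellinZeta, ← integral_complex_ofReal]
  refine setIntegral_congr_fun measurableSet_Ioi fun t ht => ?_
  simp only [ofReal_mul, ofReal_cpow (le_of_lt ht), ofReal_sub, ofReal_natCast, ofReal_one]

/-- A meromorphic function that stays bounded along some nontrivial filter approaching `z` has a
limit at `z`. -/
theorem MeromorphicAt.exists_tendsto_nhds_of_eventually_norm_le {G : ℂ → ℂ} {z : ℂ}
    (hG : MeromorphicAt G z) {ι : Type*} {l : Filter ι} [l.NeBot] {u : ι → ℂ}
    (hu : Tendsto u l (𝓝[≠] z)) {B : ℝ} (hB : ∀ᶠ i in l, ‖G (u i)‖ ≤ B) :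
    ∃ c, Tendsto G (𝓝[≠] z) (𝓝 c) := by
  rw [tendsto_nhds_iff_meromorphicOrderAt_nonneg hG]
  by_contra! h
  have h' := tendsto_norm_atTop_iff_cobounded.2
    ((tendsto_cobounded_of_meromorphicOrderAt_neg h).comp hu)
  obtain ⟨i, hi, hi'⟩ := ((h'.eventually_gt_atTop B).and hB).exists
  exact absurd hi' (not_le.2 hi)

/-- Let `(A,Ω)` be a Minkowski nondegenerate RFD in `ℝ^N` with `D := dim_B(A,Ω)` and `D < N`.
Let `U` be an open connected neighborhood of `D` and `F` meromorphic on `U` with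
`F = ζ^𝔐_{A,Ω}` on `{s ∈ U : D < Re s < N}`.  Then `D` is a simple pole of `F`:
the limit `r := lim_{s→D}(s−D)F(s)` exists, is real and nonzero; moreover
`M_*^D(A,Ω) ≤ r ≤ M^{*D}(A,Ω)`, and if `(A,Ω)` is Minkowski measurable then
`r = M^D(A,Ω)`. -/
theorem statement14
    (N : ℕ) (A Ω : Set (EuclideanSpace ℝ (Fin N))) (D : ℝ) (U : Set ℂ) (F : ℂ → ℂ)
    (hRFD : IsRFD N A Ω) (hD : IsMinkDim N A Ω D)
    (hnd₁ : 0 < lowerContent N A Ω D) (hnd₂ : upperContent N A Ω D < ⊤)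
    (hDN : D < N)
    (hU : IsOpen U) (hUconn : IsPreconnected U) (hDU : (D : ℂ) ∈ U)
    (hF : MeromorphicOn F U)
    (hFzeta : ∀ s ∈ U, D < s.re → s.re < N → F s = mellinZeta N A Ω s) :
    ∃ r : ℝ, r ≠ 0 ∧
      Tendsto (fun s : ℂ => (s - (D : ℂ)) * F s)
        (nhdsWithin (D : ℂ) {(D : ℂ)}ᶜ) (nhds (r : ℂ)) ∧
      (lowerContent N A Ω D).toReal ≤ r ∧
      r ≤ (upperContent N A Ω D).toReal ∧
      ∀ M : ℝ, MinkMeasurable N A Ω D M → r = M := by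
  have hΩ := hRFD.2.2.1
  have hα : 0 < (N : ℝ) - D := sub_pos.2 hDN
  have hVm : Measurable (tubeVol N A Ω) := (monotone_tubeVol hΩ).measurable
  have hV0 := tubeVol_nonneg N A Ω
  have hVK := tubeVol_le (A := A) hΩ
  set Z : ℝ → ℝ := fun x =>
    x * ∫ t in Ioi (0 : ℝ), t ^ (x - ((N : ℝ) - D) - 1) * tubeVol N A Ω t with hZ
  set u : ℝ → ℂ := fun x => ((D + x : ℝ) : ℂ) with hu
  have hucont : Tendsto u (𝓝[>] 0) (𝓝 (D : ℂ)) := by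
    have : ContinuousAt u 0 := by fun_prop
    simpa [hu] using this.tendsto.mono_left (nhdsWithin_le_nhds (s := Ioi 0))
  have hune : Tendsto u (𝓝[>] 0) (𝓝[≠] (D : ℂ)) := by
    refine tendsto_nhdsWithin_iff.2 ⟨hucont, ?_⟩
    filter_upwards [self_mem_nhdsWithin] with x hx
    simpa [hu] using (ne_of_gt hx : x ≠ 0)
  have hGu : ∀ᶠ x in 𝓝[>] (0 : ℝ), (u x - D) * F (u x) = (Z x : ℂ) := by
    filter_upwards [hucont.eventually (hU.mem_nhds hDU), Ioo_mem_nhdsGT hα] with x hxU hx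
    rw [hFzeta (u x) hxU (by simpa [hu] using hx.1)
      (by simp only [hu, ofReal_re]; linarith [hx.2]), hu, mellinZeta_ofReal, hZ]
    have he : D + x - (N : ℝ) - 1 = x - ((N : ℝ) - D) - 1 := by ring
    simp only [he]
    push_cast
    ring
  have hup : ∀ b : ℝ, (upperContent N A Ω D).toReal < b →
      ∀ᶠ t in 𝓝[>] (0 : ℝ), tubeVol N A Ω t ≤ b * t ^ ((N : ℝ) - D) := fun b hb =>
    eventually_tubeVol_le_of_upperContent_lt (ENNReal.toReal_nonneg.trans hb.le)
      ((ENNReal.lt_ofReal_iff_toReal_lt hnd₂.ne).2 hb)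
  obtain ⟨B, hB⟩ := exists_eventually_abs_mul_mellin_le hVm hV0 hVK hα (hup _ (lt_add_one _))
  have hGmer : MeromorphicAt (fun s : ℂ => (s - (D : ℂ)) * F s) D :=
    (by fun_prop : MeromorphicAt (fun s : ℂ => s - (D : ℂ)) D).mul (hF D hDU)
  obtain ⟨c, hc⟩ := hGmer.exists_tendsto_nhds_of_eventually_norm_le hune (B := B) (by
    filter_upwards [hGu, hB] with x hx hxB
    rw [hx, norm_real]
    exact hxB)
  have hZc : Tendsto (fun x => (Z x : ℂ)) (𝓝[>] 0) (𝓝 c) := (hc.comp hune).congr' hGu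
  have hZr : Tendsto Z (𝓝[>] 0) (𝓝 c.re) := (continuous_re.tendsto c).comp hZc
  have hcr : ((c.re : ℝ) : ℂ) = c :=
    tendsto_nhds_unique ((continuous_ofReal.tendsto c.re).comp hZr) hZc
  have hmem : ∀ {a b : ℝ}, (∀ᶠ t in 𝓝[>] (0 : ℝ), a * t ^ ((N : ℝ) - D) ≤ tubeVol N A Ω t) →
      (∀ᶠ t in 𝓝[>] (0 : ℝ), tubeVol N A Ω t ≤ b * t ^ ((N : ℝ) - D)) → c.re ∈ Icc a b :=
    fun ha hb => mem_Icc_of_tendsto_mul_mellin hVm hV0 hVK hα hZr (ha.and hb)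
  have hlow_top : lowerContent N A Ω D ≠ ⊤ := (lt_of_le_of_lt liminf_le_limsup hnd₂).ne
  have hlow_pos : 0 < (lowerContent N A Ω D).toReal := ENNReal.toReal_pos hnd₁.ne' hlow_top
  have hle : (lowerContent N A Ω D).toReal ≤ c.re := by
    refine le_of_forall_lt_imp_le_of_dense fun a ha => ?_
    refine (hmem (eventually_le_tubeVol_of_lt_lowerContent hΩ ?_) (hup _ (lt_add_one _))).1
    rcases le_or_gt 0 a with h0 | h0
    · exact (ENNReal.ofReal_lt_iff_lt_toReal h0 hlow_top).2 ha
    · rwa [ENNReal.ofReal_of_nonpos h0.le]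
  refine ⟨c.re, (hlow_pos.trans_le hle).ne', by rwa [hcr], hle, ?_, ?_⟩
  · refine le_of_forall_gt_imp_ge_of_dense fun b hb => ?_
    exact (hmem (a := 0) (by simp [hV0]) (hup b hb)).2
  · rintro M ⟨-, hM⟩
    have hpos : ∀ᶠ t in 𝓝[>] (0 : ℝ), 0 < t ^ ((N : ℝ) - D) := by
      filter_upwards [self_mem_nhdsWithin] with t ht using Real.rpow_pos_of_pos ht _
    have hlowM : ∀ a < M, ∀ᶠ t in 𝓝[>] (0 : ℝ), a * t ^ ((N : ℝ) - D) ≤ tubeVol N A Ω t := by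
      intro a ha
      filter_upwards [hM.eventually_const_lt ha, hpos] with t ht h0
      exact (le_div_iff₀ h0).1 ht.le
    have huppM : ∀ b > M, ∀ᶠ t in 𝓝[>] (0 : ℝ), tubeVol N A Ω t ≤ b * t ^ ((N : ℝ) - D) := by
      intro b hb
      filter_upwards [hM.eventually_lt_const hb, hpos] with t ht h0
      exact (div_le_iff₀ h0).1 ht.le
    refine le_antisymm (le_of_forall_gt_imp_ge_of_dense fun b hb => ?_)
      (le_of_forall_lt_imp_le_of_dense fun a ha => ?_)
    · exact (hmem (hlowM _ (sub_one_lt M)) (huppM b hb)).2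
    · exact (hmem (hlowM a ha) (huppM _ (lt_add_one M))).1

end
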